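/- arXiv:1603.01828 — 2 statements merged into one kernel-verified Lean document; each statement's English description precedes it below -/
import Mathlib

section
/- Assume n_1 = n_3 and n_2 = n_4 (so n = n_2). Fix a Smith datum (U^{(3)}, V^{(3)}, d^{(3)}_1 | … | d^{(3)}_{s_3}) for (E_{11}; E_{21}) and a Smith datum (U^{(4)}, V^{(4)}, d^{(4)}_1 | … | d^{(4)}_{s_4}) for (E_{11}; E_{12}; E_{21}; E_{22}). Define H_3 = #{(u_1,…,u_{r_1}, v_1,…,v_{r_3}) ∈ (F_q^*)^{r_1+r_3} : Σ_{i=1}^{r_1} a_{1,i} u_i = b_1, Σ_{j=1}^{r_3} a_{2,j} v_j = b_2, and (u,v) satisfies the index condition for ((E_{11}; E_{21}), U^{(3)}, d^{(3)})}; H_4 = #{(u_1,…,u_{r_2}, v_1,…,v_{r_4}) ∈ (F_q^*)^{r_2+r_4} : Σ_{i=1}^{r_2} a_{1,i} u_i = b_1, Σ_{j=1}^{r_4} a_{2,j} v_j = b_2, and (u,v) satisfies the index condition for ((E_{11}; E_{12}; E_{21}; E_{22}), U^{(4)}, d^{(4)})}; and for l = 3,4 set L_l = H_l · (q−1)^{n_l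 − s_l} · ∏_{j=1}^{s_l} gcd(q−1, d^{(l)}_j). Then N = N_0 + N_2 + N_4, where N_0 = q^{n_2−n_1}(q^{n_1} − (q−1)^{n_1}) if b_1 = b_2 = 0 and N_0 = 0 otherwise; N_2 = (q^{n_2−n_3} − (q−1)^{n_2−n_3}) L_3; and N_4 = L_4. -/
open Finset

/-- Stack the first `p1` rows of `E1` on top of the first `p2` rows of `E2`,
viewed as an integer matrix with `n` columns. -/
def stackM (E1 E2 : ℕ → ℕ → ℕ) (p1 p2 n : ℕ) :
    Matrix (Fin (p1 + p2)) (Fin n) ℤ :=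
  Matrix.of fun i j =>
    if (i : ℕ) < p1 then (E1 (i : ℕ) (j : ℕ) : ℤ) else (E2 ((i : ℕ) - p1) (j : ℕ) : ℤ)

/-- `(U, V, d 0 ∣ d 1 ∣ ⋯ ∣ d (s-1))` is a Smith datum for the matrix `M`:
`U` and `V` are unimodular and `U * M * V` is diagonal with the positive
invariant factors `d 0 ∣ ⋯ ∣ d (s-1)` on the diagonal and zeros elsewhere. -/
def IsSmithDatum {ρ n : ℕ} (M : Matrix (Fin ρ) (Fin n) ℤ)
    (U : Matrix (Fin ρ) (Fin ρ) ℤ) (V : Matrix (Fin n) (Fin n) ℤ)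
    (s : ℕ) (d : ℕ → ℕ) : Prop :=
  IsUnit U.det ∧ IsUnit V.det ∧ s ≤ ρ ∧ s ≤ n ∧
    (∀ j, j < s → 0 < d j) ∧ (∀ j, j + 1 < s → d j ∣ d (j + 1)) ∧
    ∀ i k, (U * M * V) i k =
      if (i : ℕ) = (k : ℕ) ∧ (i : ℕ) < s then (d (i : ℕ) : ℤ) else 0

/-- The index condition: writing `h' = U ⬝ w` (where `w` is the vector of
indices of the `uᵢ`), one has `gcd (m, d j) ∣ h'_j` for `j < s` and
`m ∣ h'_j` for `s ≤ j`. Here `m` plays the role of `q - 1`. -/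
def IndexCond {ρ : ℕ} (m : ℕ) (U : Matrix (Fin ρ) (Fin ρ) ℤ)
    (s : ℕ) (d : ℕ → ℕ) (w : Fin ρ → ℤ) : Prop :=
  ∀ j : Fin ρ,
    (if (j : ℕ) < s then ((Nat.gcd m (d (j : ℕ))) : ℤ) else (m : ℤ)) ∣ (U.mulVec w) j

namespace IsSmithDatum

variable {ρ n s : ℕ} {M : Matrix (Fin ρ) (Fin n) ℤ} {U : Matrix (Fin ρ) (Fin ρ) ℤ}
  {V : Matrix (Fin n) (Fin n) ℤ} {d : ℕ → ℕ}

/-- The number of invariant factors is at most the number of leading columns that contain all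
nonzero entries. -/
theorem le_of_forall_eq_zero {p : ℕ} (h : IsSmithDatum M U V s d)
    (hM : ∀ i (k : Fin n), p ≤ (k : ℕ) → M i k = 0) : s ≤ p := by
  obtain ⟨-, -, hsρ, hsn, hd, -, hD⟩ := h
  by_contra! hps
  have hpn : p ≤ n := by omega
  let A : Matrix (Fin s) (Fin p) ℤ := (U * M).submatrix (Fin.castLE hsρ) (Fin.castLE hpn)
  let B : Matrix (Fin p) (Fin s) ℤ := V.submatrix (Fin.castLE hpn) (Fin.castLE hsn)
  have hAB : A * B = Matrix.diagonal fun i : Fin s => (d i : ℤ) := by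
    ext i k
    have h1 := hD (Fin.castLE hsρ i) (Fin.castLE hsn k)
    rw [Matrix.mul_apply] at h1
    rw [Matrix.mul_apply, Matrix.diagonal_apply]
    have h2 : ∑ j : Fin p, A i j * B j k =
        ∑ j : Fin n, (U * M) (Fin.castLE hsρ i) j * V j (Fin.castLE hsn k) := by
      refine Finset.sum_of_injOn (Fin.castLE hpn) (Fin.castLE_injective hpn).injOn
        (by simp) ?_ (by simp [A, B])
      intro j _ hj
      have hpj : p ≤ (j : ℕ) := by
        by_contra! hlt
        exact hj ⟨⟨j, hlt⟩, by simp, rfl⟩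
      simp [Matrix.mul_apply, hM _ j hpj]
    rw [h2, h1]
    simp [Fin.ext_iff]
  have hdet : (A * B).det ≠ 0 := by
    rw [hAB, Matrix.det_diagonal, Finset.prod_ne_zero_iff]
    intro i _
    exact_mod_cast (hd i i.2).ne'
  have hr := Matrix.rank_of_det_ne_zero hdet
  have h1 := (Matrix.rank_mul_le_left A B).trans A.rank_le_width
  rw [hr, Fintype.card_fin] at h1
  omega

theorem map_mulVec_apply (h : IsSmithDatum M U V s d) (m : ℕ) (y : Fin n → ZMod m)
    (j : Fin ρ) :
    ((U.map (Int.castRingHom (ZMod m)) * M.map (Int.castRingHom (ZMod m)) *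
      V.map (Int.castRingHom (ZMod m))).mulVec y) j =
      if hj : (j : ℕ) < s then (d j : ZMod m) * y ⟨j, hj.trans_le h.2.2.2.1⟩ else 0 := by
  obtain ⟨-, -, -, hsn, -, -, hD⟩ := h
  rw [← Matrix.map_mul, ← Matrix.map_mul]
  simp only [Matrix.mulVec, dotProduct, Matrix.map_apply, hD]
  split_ifs with hj
  · rw [Finset.sum_eq_single ⟨j, hj.trans_le hsn⟩]
    · simp [hj]
    · intro k _ hk
      have : (j : ℕ) ≠ k := fun e => hk (Fin.ext e.symm)
      simp [this]
    · simp
  · simp [hj]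

theorem isUnit_map_left (h : IsSmithDatum M U V s d) (m : ℕ) :
    IsUnit (U.map (Int.castRingHom (ZMod m))) := by
  have := h.1.map (Int.castRingHom (ZMod m))
  rw [RingHom.map_det] at this
  exact (Matrix.isUnit_iff_isUnit_det _).2 this

theorem isUnit_map_right (h : IsSmithDatum M U V s d) (m : ℕ) :
    IsUnit (V.map (Int.castRingHom (ZMod m))) := by
  have := h.2.1.map (Int.castRingHom (ZMod m))
  rw [RingHom.map_det] at this
  exact (Matrix.isUnit_iff_isUnit_det _).2 this

theorem exists_mulVec_eq_iff (h : IsSmithDatum M U V s d) (m : ℕ) (w : Fin ρ → ZMod m) :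
    (∃ x, (M.map (Int.castRingHom (ZMod m))).mulVec x = w) ↔
      ∀ j : Fin ρ, ∃ t, ((if (j : ℕ) < s then d j else 0 : ℕ) : ZMod m) * t =
        ((U.map (Int.castRingHom (ZMod m))).mulVec w) j := by
  have hU := h.isUnit_map_left m
  have hV := h.isUnit_map_right m
  have key := h.map_mulVec_apply m
  constructor
  · rintro ⟨x, rfl⟩ j
    obtain ⟨y, rfl⟩ := Matrix.mulVec_surjective_iff_isUnit.2 hV x
    rw [Matrix.mulVec_mulVec, Matrix.mulVec_mulVec, key]
    split_ifs with hj
    · exact ⟨_, rfl⟩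
    · exact ⟨0, by simp⟩
  · intro hw
    choose t ht using hw
    refine ⟨(V.map (Int.castRingHom (ZMod m))).mulVec
      fun k => if hk : (k : ℕ) < s then t ⟨k, hk.trans_le h.2.2.1⟩ else 0, ?_⟩
    refine Matrix.mulVec_injective_of_isUnit hU ?_
    rw [Matrix.mulVec_mulVec, Matrix.mulVec_mulVec]
    ext j
    rw [key, ← ht]
    split_ifs <;> simp

theorem card_ker (h : IsSmithDatum M U V s d) (m : ℕ) [NeZero m] :
    Nat.card {x : Fin n → ZMod m // (M.map (Int.castRingHom (ZMod m))).mulVec x = 0} =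
      m ^ (n - s) * ∏ j ∈ Finset.range s, Nat.gcd m (d j) := by
  have hU := h.isUnit_map_left m
  have hV := h.isUnit_map_right m
  have key := h.map_mulVec_apply m
  let e := Equiv.ofBijective _
    ⟨Matrix.mulVec_injective_of_isUnit hV, Matrix.mulVec_surjective_iff_isUnit.2 hV⟩
  have hsn := h.2.2.2.1
  have h1 : ∀ y : Fin n → ZMod m,
      (∀ k : Fin n, ((if (k : ℕ) < s then d k else 0 : ℕ) : ZMod m) * y k = 0) ↔
        (M.map (Int.castRingHom (ZMod m))).mulVec (e y) = 0 := by
    intro y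
    have h2 : (M.map (Int.castRingHom (ZMod m))).mulVec (e y) = 0 ↔
        (U.map (Int.castRingHom (ZMod m)) * M.map (Int.castRingHom (ZMod m)) *
          V.map (Int.castRingHom (ZMod m))).mulVec y = 0 := by
      rw [← (Matrix.mulVec_injective_of_isUnit hU).eq_iff, Matrix.mulVec_zero, Matrix.mul_assoc,
        ← Matrix.mulVec_mulVec, ← Matrix.mulVec_mulVec]
      rfl
    rw [h2, funext_iff]
    constructor
    · intro hy j
      rw [key]
      split_ifs with hj
      · simpa [hj] using hy ⟨j, hj.trans_le hsn⟩
      · rfl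
    · intro hy k
      split_ifs with hk
      · have := hy ⟨k, hk.trans_le h.2.2.1⟩
        rw [key] at this
        simpa [hk] using this
      · simp
  rw [← Nat.card_congr (e.subtypeEquiv h1), Nat.card_congr (Equiv.subtypePiEquivPi
    (p := fun (k : Fin n) (t : ZMod m) => ((if (k : ℕ) < s then d k else 0 : ℕ) : ZMod m) * t = 0)),
    Nat.card_pi]
  have h3 : ∀ c : ℕ, Nat.card {t : ZMod m // (c : ZMod m) * t = 0} = Nat.gcd m c := by
    intro c
    have := IsAddCyclic.card_nsmulAddMonoidHom_ker (ZMod m) c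
    rw [Nat.card_zmod] at this
    rw [← this]
    refine Nat.card_congr (Equiv.subtypeEquivRight fun t => ?_)
    simp [AddMonoidHom.mem_ker]
  simp only [h3]
  rw [Fin.prod_univ_eq_prod_range (fun k => Nat.gcd m (if k < s then d k else 0)) n,
    ← Finset.prod_range_mul_prod_Ico _ hsn, mul_comm]
  congr 1
  · rw [Finset.prod_congr rfl (g := fun _ => m), Finset.prod_const, Nat.card_Ico]
    intro k hk
    simp [(Finset.mem_Ico.1 hk).1.not_gt]
  · refine Finset.prod_congr rfl fun k hk => ?_
    simp [Finset.mem_range.1 hk]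

end IsSmithDatum

/-- Counting the points of the domain of a homomorphism through its image and its kernel. -/
theorem AddMonoidHom.card_subtype_comp {A B : Type*} [AddGroup A] [AddGroup B] [Finite A]
    [Finite B] (f : A →+ B) (Q : B → Prop) :
    Nat.card {x // Q (f x)} = Nat.card {w // Q w ∧ ∃ x, f x = w} * Nat.card {x // f x = 0} := by
  classical
  have := Fintype.ofFinite {w // Q w ∧ ∃ x, f x = w}
  let e : {x // Q (f x)} ≃ Σ w : {w // Q w ∧ ∃ x, f x = w}, {x // f x = w.1} :=
    { toFun := fun x => ⟨⟨f x.1, x.2, x.1, rfl⟩, x.1, rfl⟩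
      invFun := fun p => ⟨p.2.1, by rw [p.2.2]; exact p.1.2.1⟩
      left_inv := fun _ => rfl
      right_inv := by
        rintro ⟨⟨w, hw⟩, x, hx⟩
        obtain rfl : f x = w := hx
        rfl }
  rw [Nat.card_congr e, Nat.card_sigma,
    Finset.sum_congr rfl (g := fun _ => Nat.card {x // f x = 0})]
  · simp [Nat.card_eq_fintype_card]
  · rintro ⟨w, hw, x, rfl⟩ _
    exact Nat.card_congr (f.fiberEquivKer x)

theorem ZMod.exists_natCast_mul_eq_intCast_iff (m c : ℕ) (z : ℤ) :
    (∃ t : ZMod m, (c : ZMod m) * t = z) ↔ (Nat.gcd m c : ℤ) ∣ z := by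
  constructor
  · rintro ⟨t, ht⟩
    obtain ⟨t, rfl⟩ := ZMod.intCast_surjective t
    have : ((c * t : ℤ) : ZMod m) = z := by push_cast; exact ht
    rw [ZMod.intCast_eq_intCast_iff_dvd_sub] at this
    have h1 : (Nat.gcd m c : ℤ) ∣ z - c * t :=
      (Int.natCast_dvd_natCast.2 (Nat.gcd_dvd_left m c)).trans this
    have h2 : (Nat.gcd m c : ℤ) ∣ c * t :=
      (Int.natCast_dvd_natCast.2 (Nat.gcd_dvd_right m c)).mul_right t
    simpa using dvd_add h1 h2
  · rintro ⟨k, rfl⟩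
    refine ⟨(Nat.gcdB m c * k : ℤ), ?_⟩
    rw [Nat.gcd_eq_gcd_ab]
    push_cast
    simp
    ring

theorem indexCond_iff {ρ m s : ℕ} (U : Matrix (Fin ρ) (Fin ρ) ℤ) (d : ℕ → ℕ) (w : Fin ρ → ℤ) :
    IndexCond m U s d w ↔ ∀ j : Fin ρ, ∃ t, ((if (j : ℕ) < s then d j else 0 : ℕ) : ZMod m) * t =
      ((U.map (Int.castRingHom (ZMod m))).mulVec fun i => (w i : ZMod m)) j := by
  refine forall_congr' fun j => ?_
  have : ((U.map (Int.castRingHom (ZMod m))).mulVec fun i => (w i : ZMod m)) j =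
      ((U.mulVec w j : ℤ) : ZMod m) := by
    simp [Matrix.mulVec, dotProduct]
  rw [this, ZMod.exists_natCast_mul_eq_intCast_iff]
  split_ifs <;> simp

/-- The discrete logarithm to the base of a generator, as an additive map to `ZMod`. -/
noncomputable def indHom {G : Type*} [CommGroup G] {α : G} (hα : ∀ β : G, β ∈ Subgroup.zpowers α) {ind : G → ℕ}
    (hind : ∀ β, α ^ ind β = β) : Additive G →+ ZMod (Nat.card G) :=
  AddMonoidHom.mk' (fun β => (ind β.toMul : ZMod (Nat.card G))) fun β γ => by
    rw [← Nat.cast_add, ZMod.natCast_eq_natCast_iff, ← orderOf_eq_card_of_forall_mem_zpowers hα,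
      ← pow_eq_pow_iff_modEq, pow_add, hind, hind, hind, toMul_add]

theorem indHom_bijective {G : Type*} [CommGroup G] [Finite G] {α : G}
    (hα : ∀ β : G, β ∈ Subgroup.zpowers α) {ind : G → ℕ} (hind : ∀ β, α ^ ind β = β) :
    Function.Bijective (indHom hα hind) := by
  have hc := orderOf_eq_card_of_forall_mem_zpowers hα
  constructor
  · intro β γ h
    change (ind β.toMul : ZMod (Nat.card G)) = ind γ.toMul at h
    rw [ZMod.natCast_eq_natCast_iff, ← hc, ← pow_eq_pow_iff_modEq, hind, hind] at h
    exact h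
  · intro z
    refine ⟨Additive.ofMul (α ^ z.val), ?_⟩
    have : NeZero (Nat.card G) := ⟨Nat.card_pos.ne'⟩
    conv_rhs => rw [← ZMod.natCast_zmod_val z]
    change (ind (α ^ z.val) : ZMod (Nat.card G)) = _
    rw [ZMod.natCast_eq_natCast_iff]
    generalize z.val = k
    rw [← hc, ← pow_eq_pow_iff_modEq, hind]

/-- The number of points of a torus over a finite cyclic group whose images under a tuple of
monomials satisfy a given condition, in terms of a Smith datum of the exponent matrix. -/
theorem IsSmithDatum.card_monomial {G : Type*} [CommGroup G] [Finite G] {α : G}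
    (hα : ∀ β : G, β ∈ Subgroup.zpowers α) {ind : G → ℕ} (hind : ∀ β, α ^ ind β = β)
    {ρ n s : ℕ} {M : Matrix (Fin ρ) (Fin n) ℤ} {U : Matrix (Fin ρ) (Fin ρ) ℤ}
    {V : Matrix (Fin n) (Fin n) ℤ} {d : ℕ → ℕ} (h : IsSmithDatum M U V s d)
    (Q : (Fin ρ → G) → Prop) :
    Nat.card {y : Fin n → G // Q fun i => ∏ j, y j ^ M i j} =
      Nat.card {w : Fin ρ → G // Q w ∧ IndexCond (Nat.card G) U s d fun i => (ind (w i) : ℤ)} *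
        (Nat.card G ^ (n - s) * ∏ j ∈ Finset.range s, Nat.gcd (Nat.card G) (d j)) := by
  have : NeZero (Nat.card G) := ⟨Nat.card_pos.ne'⟩
  let e : G ≃ ZMod (Nat.card G) :=
    Additive.ofMul.trans (Equiv.ofBijective _ (indHom_bijective hα hind))
  have he : ∀ β, e β = ((ind β : ℤ) : ZMod (Nat.card G)) := fun β => by
    rw [Int.cast_natCast]; rfl
  have hprod : ∀ (y : Fin n → G) (z : Fin n → ℤ),
      e (∏ j, y j ^ z j) = ∑ j, (z j : ZMod (Nat.card G)) * e (y j) := by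
    intro y z
    change indHom hα hind (Additive.ofMul (∏ j, y j ^ z j)) = _
    rw [ofMul_prod, map_sum]
    refine Finset.sum_congr rfl fun j _ => ?_
    rw [ofMul_zpow, map_zsmul, zsmul_eq_mul]
    rfl
  let f := (M.map (Int.castRingHom (ZMod (Nat.card G)))).mulVecLin.toAddMonoidHom
  have key := f.card_subtype_comp fun w => Q fun i => e.symm (w i)
  have hdom : Nat.card {y : Fin n → G // Q fun i => ∏ j, y j ^ M i j} =
      Nat.card {x // Q fun i => e.symm (f x i)} := by
    refine Nat.card_congr ((Equiv.arrowCongr (Equiv.refl _) e).subtypeEquiv fun y => ?_)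
    have : (fun i => ∏ j, y j ^ M i j) = fun i =>
        e.symm (f ((Equiv.arrowCongr (Equiv.refl _) e) y) i) := by
      funext i
      rw [Equiv.eq_symm_apply, hprod]
      rfl
    rw [this]
  rw [hdom, key]
  congr 1
  · refine Nat.card_congr ((Equiv.arrowCongr (Equiv.refl _) e).subtypeEquiv fun w => ?_).symm
    have h1 : (fun i => e.symm (Equiv.arrowCongr (Equiv.refl _) e w i)) = w := by
      funext i
      simp
    have h2 : (fun i => (((ind (w i) : ℤ)) : ZMod (Nat.card G))) =
        Equiv.arrowCongr (Equiv.refl _) e w := by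
      funext i
      exact (he _).symm
    rw [h1, indexCond_iff, h2, ← h.exists_mulVec_eq_iff]
    rfl
  · exact h.card_ker _

/-- The value at `x` of the polynomial with coefficients `a` and exponents given by the first
`r` rows of `E`. -/
def monomialSum {F : Type*} [Field F] (a : ℕ → Fˣ) (E : ℕ → ℕ → ℕ) (r : ℕ) {n : ℕ}
    (x : Fin n → F) : F :=
  ∑ i ∈ Finset.range r, (a i : F) * ∏ j : Fin n, x j ^ E i (j : ℕ)

theorem card_forall_ne_zero {F : Type*} [Field F] {n : ℕ} (P : (Fin n → F) → Prop) :
    Nat.card {x : Fin n → F // (∀ j, x j ≠ 0) ∧ P x} =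
      Nat.card {y : Fin n → Fˣ // P fun j => (y j : F)} := by
  refine (Nat.card_congr
    { toFun := fun y => ⟨fun j => (y.1 j : F), fun j => (y.1 j).ne_zero, y.2⟩
      invFun := fun x => ⟨fun j => Units.mk0 (x.1 j) (x.2.1 j), x.2.2⟩
      left_inv := fun y => by ext; simp
      right_inv := fun x => by ext; simp }).symm

/-- The number of points with nonzero coordinates on the intersection of two hypersurfaces. -/
theorem IsSmithDatum.card_torus {F : Type*} [Field F] [Fintype F] {α : Fˣ}
    (hα : ∀ β : Fˣ, β ∈ Subgroup.zpowers α) {ind : Fˣ → ℕ} (hind : ∀ β, α ^ ind β = β)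
    {p₁ p₂ n s : ℕ} {E₁ E₂ : ℕ → ℕ → ℕ} {U : Matrix (Fin (p₁ + p₂)) (Fin (p₁ + p₂)) ℤ}
    {V : Matrix (Fin n) (Fin n) ℤ} {d : ℕ → ℕ} (h : IsSmithDatum (stackM E₁ E₂ p₁ p₂ n) U V s d)
    (a₁ a₂ : ℕ → Fˣ) (b₁ b₂ : F) :
    Nat.card {x : Fin n → F //
        (∀ j, x j ≠ 0) ∧ monomialSum a₁ E₁ p₁ x = b₁ ∧ monomialSum a₂ E₂ p₂ x = b₂} =
      Nat.card {w : Fin (p₁ + p₂) → Fˣ //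
        (∑ i : Fin (p₁ + p₂), if (i : ℕ) < p₁ then (a₁ (i : ℕ) : F) * ((w i : F)) else 0) = b₁ ∧
        (∑ i : Fin (p₁ + p₂),
          if p₁ ≤ (i : ℕ) then (a₂ ((i : ℕ) - p₁) : F) * ((w i : F)) else 0) = b₂ ∧
        IndexCond (Fintype.card F - 1) U s d fun i => (ind (w i) : ℤ)} *
      (Fintype.card F - 1) ^ (n - s) *
      ∏ j ∈ Finset.range s, Nat.gcd (Fintype.card F - 1) (d j) := by
  have hc : Nat.card Fˣ = Fintype.card F - 1 := by
    rw [Nat.card_units, Nat.card_eq_fintype_card]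
  have key := h.card_monomial hα hind fun w =>
    (∑ i : Fin (p₁ + p₂), if (i : ℕ) < p₁ then (a₁ (i : ℕ) : F) * ((w i : F)) else 0) = b₁ ∧
    (∑ i : Fin (p₁ + p₂),
      if p₁ ≤ (i : ℕ) then (a₂ ((i : ℕ) - p₁) : F) * ((w i : F)) else 0) = b₂
  rw [hc] at key
  simp only [and_assoc] at key
  rw [card_forall_ne_zero, mul_assoc, ← key]
  refine Nat.card_congr (Equiv.subtypeEquivRight fun y => ?_)
  have hlt : ∀ i : Fin p₁, ¬ p₁ ≤ (i : ℕ) := fun i => i.2.not_ge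
  simp [monomialSum, Fin.sum_univ_add, stackM, Finset.sum_range, hlt]

theorem monomialSum_eq_of_apply_eq_zero {F : Type*} [Field F] (a : ℕ → Fˣ) {E : ℕ → ℕ → ℕ}
    {r r' n : ℕ} (hr : r ≤ r') {x : Fin n → F} {j : Fin n} (hj : x j = 0)
    (hE : ∀ i, r ≤ i → i < r' → 0 < E i j) : monomialSum a E r' x = monomialSum a E r x := by
  rw [monomialSum, ← Finset.sum_range_add_sum_Ico _ hr, Finset.sum_eq_zero (s := Finset.Ico r r'),
    add_zero, monomialSum]
  intro i hi
  rw [Finset.mem_Ico] at hi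
  rw [Finset.prod_eq_zero (Finset.mem_univ j), mul_zero]
  rw [hj, zero_pow (hE i hi.1 hi.2).ne']

theorem monomialSum_append {F : Type*} [Field F] (a : ℕ → Fˣ) {E : ℕ → ℕ → ℕ} {r n k : ℕ}
    (hE : ∀ i, i < r → ∀ j, n ≤ j → E i j = 0) (y : Fin n → F) (z : Fin k → F) :
    monomialSum a E r (Fin.append y z) = monomialSum a E r y := by
  refine Finset.sum_congr rfl fun i hi => ?_
  rw [Fin.prod_univ_add]
  simp [hE i (Finset.mem_range.1 hi)]

theorem Nat.card_subtype_eq_add {A : Type*} [Finite A] (P S : A → Prop) :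
    Nat.card {x // P x} = Nat.card {x // P x ∧ S x} + Nat.card {x // P x ∧ ¬ S x} := by
  classical
  have := Fintype.ofFinite A
  simp only [Nat.card_eq_fintype_card, Fintype.card_subtype, ← Finset.filter_filter]
  exact (Finset.card_filter_add_card_filter_not _).symm

theorem Fin.card_subtype_append {A : Type*} {n k : ℕ} {Q : (Fin (n + k) → A) → Prop}
    {R : (Fin n → A) → Prop} {S : (Fin k → A) → Prop}
    (h : ∀ y z, Q (Fin.append y z) ↔ R y ∧ S z) :
    Nat.card {x // Q x} = Nat.card {y // R y} * Nat.card {z // S z} := by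
  rw [← Nat.card_prod, ← Nat.card_congr Equiv.subtypeProdEquivProd]
  exact (Nat.card_congr ((Fin.appendEquiv n k).subtypeEquiv fun p => (h p.1 p.2).symm)).symm

theorem card_pi_ne_zero (F : Type*) [Field F] [Fintype F] (n : ℕ) :
    Nat.card {x : Fin n → F // ∀ j, x j ≠ 0} = (Fintype.card F - 1) ^ n := by
  have := card_forall_ne_zero (F := F) (n := n) fun _ => True
  simp only [and_true] at this
  rw [this, Nat.card_congr (Equiv.subtypeUnivEquiv fun _ => trivial), Nat.card_fun, Nat.card_units]
  simp

theorem card_pi_not_ne_zero (F : Type*) [Field F] [Fintype F] (n : ℕ) :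
    Nat.card {x : Fin n → F // ¬ ∀ j, x j ≠ 0} =
      Fintype.card F ^ n - (Fintype.card F - 1) ^ n := by
  have := Nat.card_subtype_eq_add (fun _ : Fin n → F => True) fun x => ∀ j, x j ≠ 0
  simp only [true_and] at this
  rw [card_pi_ne_zero, Nat.card_congr (Equiv.subtypeUnivEquiv fun _ => trivial), Nat.card_fun,
    Nat.card_eq_fintype_card (α := F), Nat.card_fin] at this
  omega

theorem rational_points_case_n1_eq_n3_n2_eq_n4
    (F : Type) [Field F] [Fintype F] [DecidableEq F]
    (q : ℕ) (hq : q = Fintype.card F)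
    (hqpow : ∃ p k : ℕ, Nat.Prime p ∧ Odd p ∧ 0 < k ∧ q = p ^ k)
    (α : Fˣ) (hα : ∀ β : Fˣ, β ∈ Subgroup.zpowers α)
    (ind : Fˣ → ℕ)
    (hind : ∀ β : Fˣ, 1 ≤ ind β ∧ ind β ≤ q - 1 ∧ α ^ ind β = β)
    (r₁ r₂ r₃ r₄ n₁ n₂ n₃ n₄ : ℕ)
    (hr₁ : 0 < r₁) (hr₁₂ : r₁ < r₂) (hr₃ : 0 < r₃) (hr₃₄ : r₃ < r₄)
    (hn₁ : 0 < n₁) (hn₁₂ : n₁ < n₂) (hn₃ : 0 < n₃) (hn₃₄ : n₃ < n₄)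
    (hn₁₃ : n₁ ≤ n₃)
    (b₁ b₂ : F) (a₁ a₂ : ℕ → Fˣ)
    (E₁ E₂ : ℕ → ℕ → ℕ)
    (hE₁p : ∀ i, i < r₁ → ∀ j, j < n₁ → 0 < E₁ i j)
    (hE₁z : ∀ i, i < r₁ → ∀ j, n₁ ≤ j → E₁ i j = 0)
    (hE₁p' : ∀ i, r₁ ≤ i → i < r₂ → ∀ j, j < n₂ → 0 < E₁ i j)
    (hE₁z' : ∀ i, r₁ ≤ i → i < r₂ → ∀ j, n₂ ≤ j → E₁ i j = 0)
    (hE₂p : ∀ i, i < r₃ → ∀ j, j < n₃ → 0 < E₂ i j)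
    (hE₂z : ∀ i, i < r₃ → ∀ j, n₃ ≤ j → E₂ i j = 0)
    (hE₂p' : ∀ i, r₃ ≤ i → i < r₄ → ∀ j, j < n₄ → 0 < E₂ i j)
    (hE₂z' : ∀ i, r₃ ≤ i → i < r₄ → ∀ j, n₄ ≤ j → E₂ i j = 0)
    (h₁₃ : n₁ = n₃) (h₂₄ : n₂ = n₄)
    (U₃ : Matrix (Fin (r₁ + r₃)) (Fin (r₁ + r₃)) ℤ) (V₃ : Matrix (Fin (n₂)) (Fin (n₂)) ℤ)
    (s₃ : ℕ) (d₃ : ℕ → ℕ)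
    (hSD₃ : IsSmithDatum (stackM E₁ E₂ r₁ r₃ n₂) U₃ V₃ s₃ d₃)
    (U₄ : Matrix (Fin (r₂ + r₄)) (Fin (r₂ + r₄)) ℤ) (V₄ : Matrix (Fin (n₂)) (Fin (n₂)) ℤ)
    (s₄ : ℕ) (d₄ : ℕ → ℕ)
    (hSD₄ : IsSmithDatum (stackM E₁ E₂ r₂ r₄ n₂) U₄ V₄ s₄ d₄)
    (H₃ : ℕ)
    (hH₃ : H₃ = Nat.card {w : Fin (r₁ + r₃) → Fˣ //
      (∑ i : Fin (r₁ + r₃), if (i : ℕ) < r₁ then (a₁ (i : ℕ) : F) * ((w i : F)) else 0) = b₁ ∧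
      (∑ i : Fin (r₁ + r₃), if r₁ ≤ (i : ℕ) then (a₂ ((i : ℕ) - r₁) : F) * ((w i : F)) else 0) = b₂ ∧
      IndexCond (q - 1) U₃ s₃ d₃ fun i => (ind (w i) : ℤ)})
    (H₄ : ℕ)
    (hH₄ : H₄ = Nat.card {w : Fin (r₂ + r₄) → Fˣ //
      (∑ i : Fin (r₂ + r₄), if (i : ℕ) < r₂ then (a₁ (i : ℕ) : F) * ((w i : F)) else 0) = b₁ ∧
      (∑ i : Fin (r₂ + r₄), if r₂ ≤ (i : ℕ) then (a₂ ((i : ℕ) - r₂) : F) * ((w i : F)) else 0) = b₂ ∧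
      IndexCond (q - 1) U₄ s₄ d₄ fun i => (ind (w i) : ℤ)})
    (L₃ : ℕ)
    (hL₃ : L₃ = H₃ * (q - 1) ^ (n₃ - s₃) * ∏ j ∈ Finset.range s₃, Nat.gcd (q - 1) (d₃ j))
    (L₄ : ℕ)
    (hL₄ : L₄ = H₄ * (q - 1) ^ (n₄ - s₄) * ∏ j ∈ Finset.range s₄, Nat.gcd (q - 1) (d₄ j))
    :
    Nat.card {x : Fin (n₂) → F //
      (∑ i ∈ Finset.range r₂, (a₁ i : F) * ∏ j : Fin (n₂), x j ^ E₁ i (j : ℕ)) = b₁ ∧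
      (∑ i ∈ Finset.range r₄, (a₂ i : F) * ∏ j : Fin (n₂), x j ^ E₂ i (j : ℕ)) = b₂} =
      (if b₁ = 0 ∧ b₂ = 0 then q ^ (n₂ - n₁) * (q ^ n₁ - (q - 1) ^ n₁) else 0) +
      (q ^ (n₂ - n₃) - (q - 1) ^ (n₂ - n₃)) * L₃ +
      L₄ := by
  subst hq h₁₃ h₂₄
  obtain ⟨l, rfl⟩ := Nat.exists_eq_add_of_le hn₁₂.le
  have hind' : ∀ β, α ^ ind β = β := fun β => (hind β).2.2
  have hq1 : 0 < Fintype.card F - 1 := Nat.sub_pos_of_lt Fintype.one_lt_card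
  have hs : s₃ ≤ n₁ := hSD₃.le_of_forall_eq_zero fun i j hj => by
    have hi := i.2
    simp only [stackM, Matrix.of_apply]
    split_ifs with h
    · simp [hE₁z i h j hj]
    · simp [hE₂z (i - r₁) (by omega) j hj]
  have h3 := hSD₃.card_torus hα hind' a₁ a₂ b₁ b₂
  have h4 := hSD₄.card_torus hα hind' a₁ a₂ b₁ b₂
  rw [← hH₃] at h3
  rw [← hH₄, ← hL₄] at h4
  let R : (Fin n₁ → F) → Prop := fun y =>
    (∀ j, y j ≠ 0) ∧ monomialSum a₁ E₁ r₁ y = b₁ ∧ monomialSum a₂ E₂ r₃ y = b₂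
  have hR : Nat.card {y // R y} = L₃ := by
    rw [Fin.card_subtype_append (R := R) (S := fun z => ∀ j, z j ≠ 0) (fun y z => by
      rw [monomialSum_append a₁ hE₁z, monomialSum_append a₂ hE₂z, Fin.forall_fin_add]
      simp only [Fin.append_left, Fin.append_right, R]
      tauto), card_pi_ne_zero, show n₁ + l - s₃ = (n₁ - s₃) + l by omega, pow_add] at h3
    refine Nat.eq_of_mul_eq_mul_right (Nat.pow_pos hq1 (n := l)) ?_
    rw [h3, hL₃]
    ring
  let P : (Fin (n₁ + l) → F) → Prop := fun x =>
    monomialSum a₁ E₁ r₂ x = b₁ ∧ monomialSum a₂ E₂ r₄ x = b₂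
  let S : (Fin (n₁ + l) → F) → Prop := fun x => ∀ j : Fin n₁, x (Fin.castAdd l j) ≠ 0
  let T : (Fin (n₁ + l) → F) → Prop := fun x => ∀ j : Fin l, x (Fin.natAdd n₁ j) ≠ 0
  have hN4 : Nat.card {x // (P x ∧ S x) ∧ T x} = L₄ := by
    rw [← h4]
    refine Nat.card_congr (Equiv.subtypeEquivRight fun x => ?_)
    simp only [Fin.forall_fin_add, P, S, T]
    tauto
  have hN2 : Nat.card {x // (P x ∧ S x) ∧ ¬ T x} =
      (Fintype.card F ^ l - (Fintype.card F - 1) ^ l) * L₃ := by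
    rw [Fin.card_subtype_append (R := R) (S := fun z => ¬ ∀ j, z j ≠ 0), card_pi_not_ne_zero, hR,
      mul_comm]
    intro y z
    simp only [P, S, T, R, Fin.append_left, Fin.append_right]
    by_cases hz : ∀ j, z j ≠ 0
    · simp [hz]
    · obtain ⟨j, hj⟩ := not_forall_not.1 hz
      have hj' : Fin.append y z (Fin.natAdd n₁ j) = 0 := by simpa using hj
      rw [monomialSum_eq_of_apply_eq_zero a₁ hr₁₂.le hj' fun i h1 h2 =>
          hE₁p' i h1 h2 _ (Fin.natAdd n₁ j).2,
        monomialSum_eq_of_apply_eq_zero a₂ hr₃₄.le hj' fun i h1 h2 =>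
          hE₂p' i h1 h2 _ (Fin.natAdd n₁ j).2,
        monomialSum_append a₁ hE₁z, monomialSum_append a₂ hE₂z]
      tauto
  have hN0 : Nat.card {x // P x ∧ ¬ S x} = if b₁ = 0 ∧ b₂ = 0 then
      Fintype.card F ^ l * (Fintype.card F ^ n₁ - (Fintype.card F - 1) ^ n₁) else 0 := by
    have hPS : ∀ x, P x ∧ ¬ S x ↔ (b₁ = 0 ∧ b₂ = 0) ∧ ¬ S x := by
      refine fun x => and_congr_left fun hx => ?_
      obtain ⟨j, hj⟩ := not_forall_not.1 hx
      simp only [P]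
      rw [monomialSum_eq_of_apply_eq_zero a₁ (Nat.zero_le _) hj,
        monomialSum_eq_of_apply_eq_zero a₂ (Nat.zero_le _) hj]
      · simp [monomialSum, eq_comm]
      · intro i _ hi
        rcases lt_or_ge i r₃ with h | h
        · exact hE₂p i h _ j.2
        · exact hE₂p' i h hi _ (Fin.castAdd l j).2
      · intro i _ hi
        rcases lt_or_ge i r₁ with h | h
        · exact hE₁p i h _ j.2
        · exact hE₁p' i h hi _ (Fin.castAdd l j).2
    rw [Nat.card_congr (Equiv.subtypeEquivRight hPS)]
    split_ifs with hb
    · rw [Fin.card_subtype_append (R := fun y => ¬ ∀ j, y j ≠ 0) (S := fun _ => True),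
        card_pi_not_ne_zero, Nat.card_congr (Equiv.subtypeUnivEquiv fun _ => trivial), Nat.card_fun,
        mul_comm]
      · simp
      · intro y z
        simp [S, hb]
    · simp [hb]
  change Nat.card {x // P x} = _
  rw [Nat.card_subtype_eq_add P S, Nat.card_subtype_eq_add _ T, hN4, hN2, hN0,
    Nat.add_sub_cancel_left]
  ring
end

section
/- Assume n_1 = n_3 and n_2 > n_4 (so n_1 = n_3 < n_4 < n_2 and n = n_2). Fix a Smith datum (U^{(3)}, V^{(3)}, d^{(3)}_1 | … | d^{(3)}_{s_3}) for (E_{11}; E_{21}), a Smith datum (U^{(2)}, V^{(2)}, d^{(2)}_1 | … | d^{(2)}_{s_2}) for (E_{11}; E_{12}; E_{21}; E_{22}), and a Smith datum (U^{(4)}, V^{(4)}, d^{(4)}_1 | … | d^{(4)}_{s_4}) for (E_{11}; E_{21}; E_{22}). Define H_3 = #{(u_1,…,u_{r_1}, v_1,…,v_{r_3}) ∈ (F_q^*)^{r_1+r_3} : Σ_{i=1}^{r_1} a_{1,i} u_i = b_1, Σ_{j=1}^{r_3} a_{2,j} v_j = b_2, and (u,v) satisfies the index condition for ((E_{11}; E_{21}),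 U^{(3)}, d^{(3)})}; H_2 = #{(u_1,…,u_{r_2}, v_1,…,v_{r_4}) ∈ (F_q^*)^{r_2+r_4} : Σ_{i=1}^{r_2} a_{1,i} u_i = b_1, Σ_{j=1}^{r_4} a_{2,j} v_j = b_2, and (u,v) satisfies the index condition for ((E_{11}; E_{12}; E_{21}; E_{22}), U^{(2)}, d^{(2)})}; H_4 = #{(u_1,…,u_{r_1}, v_1,…,v_{r_4}) ∈ (F_q^*)^{r_1+r_4} : Σ_{i=1}^{r_1} a_{1,i} u_i = b_1, Σ_{j=1}^{r_4} a_{2,j} v_j = b_2, and (u,v) satisfies the index condition for ((E_{11}; E_{21}; E_{22}), U^{(4)}, d^{(4)})}; and for l = 2,3,4 set L_l = H_l · (q−1)^{n_l − s_l} · ∏_{j=1}^{s_l} gcd(q−1, d^{(l)}_j). Then N = N_0 + N_2 + N_4 + N_5, where N_0 = q^{n_2−n_1}(q^{n_1} − (q−1)^{n_1}) if b_1 = b_2 = 0 and N_0 = 0 otherwise; N_2 = q^{n_2−n_4}(q^{n_4−n_3} − (q−1)^{n_4−n_3}) L_3; N_4 = L_2; and N_5 = (q^{n_2−n_4} − (q−1)^{n_2−n_4})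 L_4. -/
open Finset

open scoped Classical in
theorem card_zmod_mul_eq (m : ℕ) [NeZero m] (d : ℕ) (c : ℤ) :
    #{x : ZMod m | (d : ZMod m) * x = (c : ZMod m)} =
      if ((m.gcd d : ℕ) : ℤ) ∣ c then m.gcd d else 0 := by
  have hsolv : (∃ x : ZMod m, (d : ZMod m) * x = (c : ZMod m)) ↔ ((m.gcd d : ℕ) : ℤ) ∣ c := by
    constructor
    · rintro ⟨x, hx⟩
      obtain ⟨z, rfl⟩ := ZMod.intCast_surjective x
      have h : ((d * z - c : ℤ) : ZMod m) = 0 := by push_cast; rw [hx, sub_self]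
      rw [ZMod.intCast_zmod_eq_zero_iff_dvd] at h
      have h1 : ((m.gcd d : ℕ) : ℤ) ∣ d * z - c :=
        (Int.natCast_dvd_natCast.2 (Nat.gcd_dvd_left m d)).trans h
      have h2 : ((m.gcd d : ℕ) : ℤ) ∣ d * z :=
        (Int.natCast_dvd_natCast.2 (Nat.gcd_dvd_right m d)).mul_right z
      exact (dvd_sub_right h2).1 h1
    · rintro ⟨z, rfl⟩
      refine ⟨((Nat.gcdB m d * z : ℤ) : ZMod m), ?_⟩
      rw [Nat.gcd_eq_gcd_ab]
      push_cast
      rw [ZMod.natCast_self]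
      ring
  split_ifs with h
  · let f : ZMod m →+ ZMod m := nsmulAddMonoidHom d
    have hf : ∀ x, f x = (d : ZMod m) * x := fun x => by simp [f]
    obtain ⟨x₀, hx₀⟩ := hsolv.2 h
    have h1 := AddMonoidHom.card_fiber_eq_of_mem_range f (x := (c : ZMod m)) (y := 0)
      ⟨x₀, by rw [hf, hx₀]⟩ ⟨0, map_zero f⟩
    simp only [hf] at h1
    rw [h1]
    have h2 := IsAddCyclic.card_nsmulAddMonoidHom_ker (G := ZMod m) d
    rw [Nat.card_zmod] at h2
    rw [← h2, Nat.card_eq_fintype_card, ← Fintype.card_subtype]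
    exact Fintype.card_congr (Equiv.subtypeEquivRight fun x => by
      rw [AddMonoidHom.mem_ker, ← hf])
  · rw [Finset.card_eq_zero, Finset.filter_eq_empty_iff]
    exact fun x _ hx => h (hsolv.1 ⟨x, hx⟩)

theorem prod_fin_ite_lt {n s : ℕ} (hs : s ≤ n) (g : ℕ → ℕ) (m : ℕ) :
    ∏ k : Fin n, (if (k : ℕ) < s then g k else m) = m ^ (n - s) * ∏ j ∈ range s, g j := by
  obtain ⟨e, rfl⟩ := Nat.exists_eq_add_of_le hs
  rw [Fin.prod_univ_add]
  simp [Finset.prod_range, mul_comm]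

open scoped Classical in
/-- The number of solutions of a linear system over `ℤ/m`, read off from a Smith datum. -/
theorem card_mulVec_eq_of_isSmithDatum (m : ℕ) [NeZero m] {ρ n : ℕ}
    {M : Matrix (Fin ρ) (Fin n) ℤ} {U : Matrix (Fin ρ) (Fin ρ) ℤ}
    {V : Matrix (Fin n) (Fin n) ℤ} {s : ℕ} {d : ℕ → ℕ} (h : IsSmithDatum M U V s d)
    (w : Fin ρ → ℤ) :
    #{x : Fin n → ZMod m |
        (M.map (Int.castRingHom (ZMod m))).mulVec x = fun i => (w i : ZMod m)} =
      if IndexCond m U s d w then m ^ (n - s) * ∏ j ∈ range s, m.gcd (d j) else 0 := by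
  obtain ⟨hU, hV, hsρ, hsn, -, -, hD⟩ := h
  let φ := Int.castRingHom (ZMod m)
  have hU' : IsUnit (U.map φ) := ((Matrix.isUnit_iff_isUnit_det U).2 hU).map φ.mapMatrix
  have hV' : IsUnit (V.map φ) := ((Matrix.isUnit_iff_isUnit_det V).2 hV).map φ.mapMatrix
  let c : ℕ → ℤ := fun k => if hk : k < ρ then U.mulVec w ⟨k, hk⟩ else 0
  have hc : ∀ i : Fin ρ, c i = U.mulVec w i := fun i => by simp [c]
  let S : Fin n → Finset (ZMod m) := fun k =>
    if (k : ℕ) < s then univ.filter fun x => (d k : ZMod m) * x = (c k : ZMod m) else univ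
  have key : ∀ z : Fin n → ZMod m,
      ((M.map φ).mulVec ((V.map φ).mulVec z) = fun i => (w i : ZMod m)) ↔
      (z ∈ Fintype.piFinset S ∧ ∀ i : Fin ρ, s ≤ i → (m : ℤ) ∣ U.mulVec w i) := by
    intro z
    rw [← (Matrix.mulVec_injective_of_isUnit hU').eq_iff, Matrix.mulVec_mulVec,
      Matrix.mulVec_mulVec, ← Matrix.map_mul, ← Matrix.map_mul]
    have hr : (U.map φ).mulVec (fun i => (w i : ZMod m)) = fun i => ((U.mulVec w i : ℤ) : ZMod m) := by
      funext i
      exact (RingHom.map_mulVec φ U w i).symm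
    have hl : ∀ i : Fin ρ, (((U * M * V).map φ).mulVec z) i =
        if hi : (i : ℕ) < s then (d i : ZMod m) * z ⟨i, hi.trans_le hsn⟩ else 0 := by
      intro i
      simp only [Matrix.mulVec, dotProduct, Matrix.map_apply, hD]
      split_ifs with hi
      · rw [Finset.sum_eq_single ⟨i, hi.trans_le hsn⟩]
        · simp [hi, φ]
        · intro k _ hk
          rw [if_neg, map_zero, zero_mul]
          rintro ⟨h1, -⟩
          exact hk (Fin.ext h1.symm)
        · simp
      · simp [hi]
    rw [hr, funext_iff]
    simp only [hl, Fintype.mem_piFinset]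
    constructor
    · intro H
      refine ⟨fun k => ?_, fun i hi => ?_⟩
      · by_cases hk : (k : ℕ) < s
        · have := H ⟨k, hk.trans_le hsρ⟩
          simp only [hk, dif_pos] at this
          simp only [S, hk, if_true, mem_filter, mem_univ, true_and]
          rw [this, ← hc]
        · simp [S, hk]
      · have := H i
        rw [dif_neg (not_lt.2 hi)] at this
        exact (ZMod.intCast_zmod_eq_zero_iff_dvd _ _).1 this.symm
    · rintro ⟨H1, H2⟩ i
      split_ifs with hi
      · have := H1 ⟨i, hi.trans_le hsn⟩
        simp only [S, hi, if_true, mem_filter, mem_univ, true_and] at this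
        rw [this, hc]
      · exact ((ZMod.intCast_zmod_eq_zero_iff_dvd _ _).2 (H2 i (not_lt.1 hi))).symm
  have hbij : Function.Bijective (V.map φ).mulVec :=
    Finite.injective_iff_bijective.1 (Matrix.mulVec_injective_of_isUnit hV')
  have hcard : #{x : Fin n → ZMod m | (M.map φ).mulVec x = fun i => (w i : ZMod m)} =
      #{z : Fin n → ZMod m |
        z ∈ Fintype.piFinset S ∧ ∀ i : Fin ρ, s ≤ i → (m : ℤ) ∣ U.mulVec w i} := by
    refine (Finset.card_bijective _ hbij fun z => ?_).symm
    simp only [mem_filter, mem_univ, true_and]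
    exact (key z).symm
  have hS : ∀ k : Fin n, #(S k) = if (k : ℕ) < s then
      (if ((m.gcd (d k) : ℕ) : ℤ) ∣ c k then m.gcd (d k) else 0) else m := by
    intro k
    by_cases hk : (k : ℕ) < s
    · simp only [S, hk, if_true]
      exact card_zmod_mul_eq m (d k) (c k)
    · simp [S, hk, ZMod.card]
  rw [hcard]
  split_ifs with hI
  · have h2 : ∀ i : Fin ρ, s ≤ i → (m : ℤ) ∣ U.mulVec w i := fun i hi => by
      have := hI i
      rwa [if_neg (not_lt.2 hi)] at this
    have hpi : univ.filter (fun z : Fin n → ZMod m => z ∈ Fintype.piFinset S ∧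
        ∀ i : Fin ρ, s ≤ i → (m : ℤ) ∣ U.mulVec w i) = Fintype.piFinset S := by
      ext z
      rw [mem_filter]
      exact ⟨fun hz => hz.2.1, fun hz => ⟨mem_univ _, hz, h2⟩⟩
    rw [hpi, Fintype.card_piFinset, ← prod_fin_ite_lt hsn]
    refine Finset.prod_congr rfl fun k _ => ?_
    rw [hS]
    by_cases hk : (k : ℕ) < s
    · have := hI ⟨k, hk.trans_le hsρ⟩
      rw [← hc] at this
      simp only [hk, if_true] at this ⊢
      rw [if_pos this]
    · simp [hk]
  · rw [Finset.card_eq_zero, Finset.filter_eq_empty_iff]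
    rintro z - ⟨h1, h2⟩
    refine hI fun i => ?_
    by_cases hi : (i : ℕ) < s
    · rw [if_pos hi]
      by_contra hn
      have h3 := hS ⟨i, hi.trans_le hsn⟩
      simp only [hi, if_true] at h3
      rw [hc, if_neg hn, Finset.card_eq_zero] at h3
      have h4 := Fintype.mem_piFinset.1 h1 ⟨i, hi.trans_le hsn⟩
      rw [h3] at h4
      simp at h4
    · rw [if_neg hi]
      exact h2 i (not_lt.1 hi)

/-- The number of invariant factors is at most the number of nonzero columns. -/
theorem IsSmithDatum.le_of_cols_eq_zero {ρ n : ℕ}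
    {M : Matrix (Fin ρ) (Fin n) ℤ} {U : Matrix (Fin ρ) (Fin ρ) ℤ}
    {V : Matrix (Fin n) (Fin n) ℤ} {s : ℕ} {d : ℕ → ℕ} (h : IsSmithDatum M U V s d)
    {k : ℕ} (hk : k ≤ n) (hM : ∀ i, ∀ j : Fin n, k ≤ j → M i j = 0) : s ≤ k := by
  obtain ⟨hU, hV, hsρ, hsn, hpos, -, hD⟩ := h
  let P : Matrix (Fin s) (Fin k) ℤ := (U * M).submatrix (Fin.castLE hsρ) (Fin.castLE hk)
  let Q : Matrix (Fin k) (Fin s) ℤ := V.submatrix (Fin.castLE hk) (Fin.castLE hsn)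
  have hUM : ∀ i, ∀ j : Fin n, k ≤ j → (U * M) i j = 0 := fun i j hj => by
    simp [Matrix.mul_apply, hM _ j hj]
  have hPQ : P * Q = Matrix.diagonal fun i : Fin s => (d i : ℤ) := by
    ext i j
    have h1 := hD (Fin.castLE hsρ i) (Fin.castLE hsn j)
    have h2 : (P * Q) i j = (U * M * V) (Fin.castLE hsρ i) (Fin.castLE hsn j) := by
      obtain ⟨e, rfl⟩ := Nat.exists_eq_add_of_le hk
      rw [Matrix.mul_apply, Matrix.mul_apply, Fin.sum_univ_add]
      refine Eq.symm ((congrArg _ (Finset.sum_eq_zero fun l _ => ?_)).trans (add_zero _))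
      rw [hUM _ _ (by simp), zero_mul]
    rw [h2, h1, Matrix.diagonal_apply]
    simp [Fin.ext_iff]
  have hdet : (P * Q).det ≠ 0 := by
    rw [hPQ, Matrix.det_diagonal, Finset.prod_ne_zero_iff]
    exact fun i _ => by exact_mod_cast (hpos i i.2).ne'
  have hinj : Function.Injective Q.mulVecLin := by
    intro x y hxy
    apply Matrix.mulVec_injective_of_det_ne_zero hdet
    simp only [← Matrix.mulVec_mulVec]
    exact congrArg P.mulVec hxy
  simpa using card_le_of_injective ℤ Q.mulVecLin hinj

/-- A system of discrete logarithms with respect to a generator is an isomorphism onto `ℤ/m`. -/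
theorem exists_addEquiv_zmod_of_index {G : Type*} [CommGroup G] [Fintype G] {α : G}
    (hα : ∀ β : G, β ∈ Subgroup.zpowers α) {ind : G → ℕ} (hind : ∀ β, α ^ ind β = β)
    {m : ℕ} [NeZero m] (hm : Fintype.card G = m) :
    ∃ e : Additive G ≃+ ZMod m, ∀ β : G, e (Additive.ofMul β) = (ind β : ZMod m) := by
  have hord : orderOf α = m := by
    rw [orderOf_eq_card_of_forall_mem_zpowers hα, Nat.card_eq_fintype_card, hm]
  have hiff : ∀ a b : ℕ, α ^ a = α ^ b ↔ (a : ZMod m) = (b : ZMod m) := fun a b => by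
    rw [pow_eq_pow_iff_modEq, hord, ZMod.natCast_eq_natCast_iff]
  let f : Additive G →+ ZMod m := AddMonoidHom.mk' (fun x => (ind x.toMul : ZMod m)) fun x y => by
    rw [← Nat.cast_add, ← hiff, pow_add, hind, hind, hind, toMul_add]
  have hf : Function.Bijective f := by
    rw [Fintype.bijective_iff_injective_and_card]
    refine ⟨fun x y hxy => ?_, by
      rw [ZMod.card, Fintype.card_congr Additive.toMul, hm]⟩
    have h : (ind x.toMul : ZMod m) = (ind y.toMul : ZMod m) := hxy
    rw [← hiff, hind, hind] at h
    exact Additive.toMul.injective h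
  exact ⟨AddEquiv.ofBijective f hf, fun β => rfl⟩

open scoped Classical in
/-- The fibres of a monomial map between tori over a cyclic group. -/
theorem card_monomial_fiber {G : Type*} [CommGroup G] [Fintype G] {α : G}
    (hα : ∀ β : G, β ∈ Subgroup.zpowers α) {ind : G → ℕ} (hind : ∀ β, α ^ ind β = β)
    {m : ℕ} [NeZero m] (hm : Fintype.card G = m) {ρ n : ℕ} (E : Fin ρ → Fin n → ℕ)
    {U : Matrix (Fin ρ) (Fin ρ) ℤ} {V : Matrix (Fin n) (Fin n) ℤ} {s : ℕ} {d : ℕ → ℕ}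
    (h : IsSmithDatum (Matrix.of fun i j => (E i j : ℤ)) U V s d) (w : Fin ρ → G) :
    #{y : Fin n → G | (fun i => ∏ j, y j ^ E i j) = w} =
      if IndexCond m U s d (fun i => (ind (w i) : ℤ)) then
        m ^ (n - s) * ∏ j ∈ range s, m.gcd (d j) else 0 := by
  obtain ⟨e, he⟩ := exists_addEquiv_zmod_of_index hα hind hm
  rw [← card_mulVec_eq_of_isSmithDatum m h]
  let φ : (Fin n → G) ≃ (Fin n → ZMod m) :=
    Equiv.piCongrRight fun _ => Additive.ofMul.trans e.toEquiv
  refine Finset.card_equiv φ fun y => ?_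
  simp only [mem_filter, mem_univ, true_and, funext_iff]
  refine forall_congr' fun i => ?_
  rw [← (Additive.ofMul.trans e.toEquiv).injective.eq_iff]
  have h1 : (Additive.ofMul.trans e.toEquiv) (w i) = (((ind (w i) : ℕ) : ℤ) : ZMod m) := by
    rw [Int.cast_natCast]
    exact he (w i)
  have h2 : (Additive.ofMul.trans e.toEquiv) (∏ j, y j ^ E i j) =
      (((Matrix.of fun i j => (E i j : ℤ)).map (Int.castRingHom (ZMod m))).mulVec (φ y)) i := by
    change e (Additive.ofMul (∏ j, y j ^ E i j)) = _
    rw [ofMul_prod, map_sum, Matrix.mulVec, dotProduct]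
    refine Finset.sum_congr rfl fun j _ => ?_
    rw [ofMul_pow, map_nsmul, nsmul_eq_mul]
    simp [φ]
  rw [h1, h2]

open scoped Classical in
theorem card_monomial_preimage {G : Type*} [CommGroup G] [Fintype G] {α : G}
    (hα : ∀ β : G, β ∈ Subgroup.zpowers α) {ind : G → ℕ} (hind : ∀ β, α ^ ind β = β)
    {m : ℕ} [NeZero m] (hm : Fintype.card G = m) {ρ n : ℕ} (E : Fin ρ → Fin n → ℕ)
    {U : Matrix (Fin ρ) (Fin ρ) ℤ} {V : Matrix (Fin n) (Fin n) ℤ} {s : ℕ} {d : ℕ → ℕ}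
    (h : IsSmithDatum (Matrix.of fun i j => (E i j : ℤ)) U V s d) (P : (Fin ρ → G) → Prop) :
    #{y : Fin n → G | P fun i => ∏ j, y j ^ E i j} =
      #{w : Fin ρ → G | P w ∧ IndexCond m U s d fun i => (ind (w i) : ℤ)} *
        (m ^ (n - s) * ∏ j ∈ range s, m.gcd (d j)) := by
  rw [Finset.card_eq_sum_card_fiberwise (f := fun y : Fin n → G => fun i => ∏ j, y j ^ E i j)
    (t := univ.filter P) (fun y hy => by simpa using hy), ← Finset.filter_filter,
    Finset.card_filter (s := univ.filter P), Finset.sum_mul]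
  refine Finset.sum_congr rfl fun w hw => ?_
  rw [ite_mul, one_mul, zero_mul, ← card_monomial_fiber hα hind hm E h]
  congr 1
  ext y
  simp only [mem_filter, mem_univ, true_and] at hw ⊢
  exact ⟨fun hy => hy.2, fun hy => ⟨hy ▸ hw, hy⟩⟩

/-- The first `l` coordinates of `x` are nonzero. -/
def HeadNonzero {F : Type*} [Zero F] {n : ℕ} (l : ℕ) (x : Fin n → F) : Prop :=
  ∀ j : Fin n, (j : ℕ) < l → x j ≠ 0

open scoped Classical in
/-- Counting points of a cylinder over the first `k` coordinates whose first `l` coordinates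
are nonzero. -/
theorem exists_card_cylinder {F : Type*} [Field F] [Fintype F] {n k : ℕ} (hkn : k ≤ n)
    (Q : (Fin n → F) → Prop)
    (hQ : ∀ x x' : Fin n → F, (∀ j : Fin n, (j : ℕ) < k → x j = x' j) → (Q x ↔ Q x')) :
    ∃ T : ℕ, ∀ l, k ≤ l → l ≤ n →
      #{x : Fin n → F | Q x ∧ HeadNonzero l x} =
        T * (Fintype.card F - 1) ^ (l - k) * Fintype.card F ^ (n - l) := by
  obtain ⟨e, rfl⟩ := Nat.exists_eq_add_of_le hkn
  refine ⟨#{u : Fin k → F | Q (Fin.append u 0) ∧ ∀ j, u j ≠ 0}, fun l hkl hl => ?_⟩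
  have hZ : #(Fintype.piFinset fun j : Fin e =>
      if (j : ℕ) < l - k then univ.filter (fun a : F => a ≠ 0) else univ) =
      (Fintype.card F - 1) ^ (l - k) * Fintype.card F ^ (k + e - l) := by
    rw [Fintype.card_piFinset]
    have h1 : ∀ j : Fin e, #(if (j : ℕ) < l - k then univ.filter (fun a : F => a ≠ 0) else univ) =
        if (j : ℕ) < l - k then (fun _ : ℕ => Fintype.card F - 1) j else Fintype.card F := by
      intro j
      split_ifs
      · rw [Finset.filter_ne' univ (0 : F), Finset.card_erase_of_mem (mem_univ _), card_univ]
      · rw [card_univ]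
    rw [Finset.prod_congr rfl fun j _ => h1 j, 
      prod_fin_ite_lt (by omega) (fun _ => Fintype.card F - 1), prod_const, card_range,
      mul_comm]
    congr 2
    omega
  rw [mul_assoc, ← hZ, ← Finset.card_product]
  symm
  refine Finset.card_equiv (Fin.appendEquiv k e) fun p => ?_
  obtain ⟨u, v⟩ := p
  have hQ' : Q (Fin.append u v) ↔ Q (Fin.append u 0) := hQ _ _ fun j => by
    refine Fin.addCases (fun i _ => by simp) (fun i hi => ?_) j
    simp at hi
  simp only [HeadNonzero, mem_product, mem_filter, mem_univ, true_and, Fin.appendEquiv, Equiv.coe_fn_mk,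
    Fintype.mem_piFinset, hQ', Fin.forall_fin_add, Fin.append_left, Fin.append_right,
    Fin.val_castAdd, Fin.val_natAdd, and_assoc]
  refine and_congr_right fun _ => and_congr
    (forall_congr' fun i => ⟨fun h _ => h, fun h => h (i.2.trans_le hkl)⟩)
    (forall_congr' fun i => ?_)
  by_cases hi : (i : ℕ) < l - k
  · simp [hi, show k + (i : ℕ) < l by omega]
  · simp [hi, show ¬ k + (i : ℕ) < l by omega]

/-- The pair of equations formed by the first `p₁` and the first `p₂` monomials. -/
def MonomialSystem {F : Type*} [Field F] (b₁ b₂ : F) (a₁ a₂ : ℕ → Fˣ) (E₁ E₂ : ℕ → ℕ → ℕ)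
    (p₁ p₂ : ℕ) {n : ℕ} (x : Fin n → F) : Prop :=
  (∑ i ∈ range p₁, (a₁ i : F) * ∏ j : Fin n, x j ^ E₁ i (j : ℕ)) = b₁ ∧
    (∑ i ∈ range p₂, (a₂ i : F) * ∏ j : Fin n, x j ^ E₂ i (j : ℕ)) = b₂

theorem prod_pow_eq_of_agree {F : Type*} [Field F] {n k : ℕ} {e : ℕ → ℕ}
    (he : ∀ j, k ≤ j → e j = 0) {x x' : Fin n → F}
    (hx : ∀ j : Fin n, (j : ℕ) < k → x j = x' j) :
    ∏ j : Fin n, x j ^ e j = ∏ j : Fin n, x' j ^ e j := by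
  refine Finset.prod_congr rfl fun j _ => ?_
  by_cases hj : (j : ℕ) < k
  · rw [hx j hj]
  · rw [he j (not_lt.1 hj), pow_zero, pow_zero]

theorem sum_range_truncate {F : Type*} [Field F] {n l p p' : ℕ} (hp : p ≤ p')
    (a : ℕ → Fˣ) (E : ℕ → ℕ → ℕ) (hE : ∀ i, p ≤ i → i < p' → ∀ j, j < l → 0 < E i j)
    {x : Fin n → F} (hx : ¬ HeadNonzero l x) :
    ∑ i ∈ range p', (a i : F) * ∏ j : Fin n, x j ^ E i (j : ℕ) =
      ∑ i ∈ range p, (a i : F) * ∏ j : Fin n, x j ^ E i (j : ℕ) := by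
  unfold HeadNonzero at hx
  push Not at hx
  obtain ⟨j, hj, hj0⟩ := hx
  refine (Finset.sum_subset (range_subset_range.2 hp) fun i hi hi' => ?_).symm
  rw [mem_range] at hi hi'
  rw [Finset.prod_eq_zero (mem_univ j), mul_zero]
  rw [hj0, zero_pow (hE i (not_lt.1 hi') hi j hj).ne']

open scoped Classical in
theorem card_headNonzero_eq_card_units {F : Type*} [Field F] [Fintype F] {n : ℕ}
    (Q : (Fin n → F) → Prop) :
    #{x : Fin n → F | Q x ∧ HeadNonzero n x} =
      #{y : Fin n → Fˣ | Q fun j => (y j : F)} := by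
  symm
  refine Finset.card_bij (fun y _ j => (y j : F)) (fun y hy => ?_) (fun y _ y' _ h => ?_)
    fun x hx => ?_
  · simpa [HeadNonzero] using hy
  · funext j
    exact Units.ext (congrFun h j)
  · simp only [mem_filter, mem_univ, true_and] at hx
    exact ⟨fun j => Units.mk0 (x j) (hx.2 j j.2), by simpa using hx.1, rfl⟩

theorem sum_fin_add_ite_lt {F : Type*} [Field F] (p₁ p₂ : ℕ) (g : ℕ → F) :
    (∑ i : Fin (p₁ + p₂), if (i : ℕ) < p₁ then g i else 0) = ∑ i ∈ range p₁, g i := by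
  simp [Fin.sum_univ_add, Finset.sum_range]

theorem sum_fin_add_ite_ge {F : Type*} [Field F] (p₁ p₂ : ℕ) (g : ℕ → F) :
    (∑ i : Fin (p₁ + p₂), if p₁ ≤ (i : ℕ) then g (i - p₁) else 0) = ∑ i ∈ range p₂, g i := by
  have h : ∀ i : Fin p₁, ¬ p₁ ≤ (i : ℕ) := fun i => not_le.2 i.2
  simp [h, Fin.sum_univ_add, Finset.sum_range]

open scoped Classical in
/-- Counting solutions of a monomial system in the first `k` coordinates, all of whose first `l`
coordinates are nonzero. -/
theorem card_monomialSystem {F : Type*} [Field F] [Fintype F] {α : Fˣ}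
    (hα : ∀ β : Fˣ, β ∈ Subgroup.zpowers α) {ind : Fˣ → ℕ} (hind : ∀ β, α ^ ind β = β)
    (b₁ b₂ : F) (a₁ a₂ : ℕ → Fˣ) (E₁ E₂ : ℕ → ℕ → ℕ) (p₁ p₂ : ℕ) {n k : ℕ} (hkn : k ≤ n)
    (hE₁ : ∀ i, i < p₁ → ∀ j, k ≤ j → E₁ i j = 0) (hE₂ : ∀ i, i < p₂ → ∀ j, k ≤ j → E₂ i j = 0)
    {U : Matrix (Fin (p₁ + p₂)) (Fin (p₁ + p₂)) ℤ} {V : Matrix (Fin n) (Fin n) ℤ} {s : ℕ}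
    {d : ℕ → ℕ} (h : IsSmithDatum (stackM E₁ E₂ p₁ p₂ n) U V s d) (l : ℕ) (hkl : k ≤ l)
    (hl : l ≤ n) :
    #{x : Fin n → F | MonomialSystem b₁ b₂ a₁ a₂ E₁ E₂ p₁ p₂ x ∧
        HeadNonzero l x} =
      Nat.card {w : Fin (p₁ + p₂) → Fˣ //
        (∑ i : Fin (p₁ + p₂), if (i : ℕ) < p₁ then (a₁ (i : ℕ) : F) * ((w i : F)) else 0) = b₁ ∧
        (∑ i : Fin (p₁ + p₂), if p₁ ≤ (i : ℕ) then (a₂ ((i : ℕ) - p₁) : F) * ((w i : F)) else 0)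
          = b₂ ∧
        IndexCond (Fintype.card F - 1) U s d fun i => (ind (w i) : ℤ)} *
        (Fintype.card F - 1) ^ (k - s) *
        (∏ j ∈ range s, Nat.gcd (Fintype.card F - 1) (d j)) *
        (Fintype.card F - 1) ^ (l - k) * Fintype.card F ^ (n - l) := by
  have hm : 0 < Fintype.card F - 1 := Nat.sub_pos_of_lt Fintype.one_lt_card
  have : NeZero (Fintype.card F - 1) := ⟨hm.ne'⟩
  let E : Fin (p₁ + p₂) → Fin n → ℕ := fun i j =>
    if (i : ℕ) < p₁ then E₁ i j else E₂ (i - p₁) j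
  have hM : stackM E₁ E₂ p₁ p₂ n = Matrix.of fun i j => (E i j : ℤ) := by
    ext i j
    simp [stackM, E]
  have hsk : s ≤ k := h.le_of_cols_eq_zero hkn fun i j hj => by
    simp only [stackM, Matrix.of_apply]
    split_ifs with hi
    · rw [hE₁ _ hi _ hj, Nat.cast_zero]
    · rw [hE₂ _ (by omega) _ hj, Nat.cast_zero]
  obtain ⟨T, hT⟩ := exists_card_cylinder hkn (MonomialSystem b₁ b₂ a₁ a₂ E₁ E₂ p₁ p₂)
    fun x x' hx => by
      unfold MonomialSystem
      rw [Finset.sum_congr rfl fun i hi => by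
          rw [prod_pow_eq_of_agree (hE₁ i (mem_range.1 hi)) hx],
        Finset.sum_congr (s₁ := range p₂) rfl fun i hi => by
          rw [prod_pow_eq_of_agree (hE₂ i (mem_range.1 hi)) hx]]
  let P : (Fin (p₁ + p₂) → Fˣ) → Prop := fun w =>
    (∑ i : Fin (p₁ + p₂), if (i : ℕ) < p₁ then (a₁ (i : ℕ) : F) * ((w i : F)) else 0) = b₁ ∧
      (∑ i : Fin (p₁ + p₂), if p₁ ≤ (i : ℕ) then (a₂ ((i : ℕ) - p₁) : F) * ((w i : F)) else 0)
        = b₂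
  have hP : ∀ y : Fin n → Fˣ, MonomialSystem b₁ b₂ a₁ a₂ E₁ E₂ p₁ p₂ (fun j => (y j : F)) ↔
      P fun i => ∏ j, y j ^ E i j := by
    intro y
    unfold MonomialSystem
    rw [← sum_fin_add_ite_lt p₁ p₂, ← sum_fin_add_ite_ge p₁ p₂]
    have h1 : ∀ i : Fin (p₁ + p₂),
        (if (i : ℕ) < p₁ then (a₁ i : F) * ∏ j : Fin n, (y j : F) ^ E₁ i (j : ℕ) else 0) =
        if (i : ℕ) < p₁ then (a₁ (i : ℕ) : F) * ((∏ j, y j ^ E i j : Fˣ) : F) else 0 := by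
      intro i
      split_ifs with hi
      · simp [E, hi]
      · rfl
    have h2 : ∀ i : Fin (p₁ + p₂),
        (if p₁ ≤ (i : ℕ) then
          (a₂ (i - p₁) : F) * ∏ j : Fin n, (y j : F) ^ E₂ (i - p₁) (j : ℕ) else 0) =
        if p₁ ≤ (i : ℕ) then (a₂ (i - p₁) : F) * ((∏ j, y j ^ E i j : Fˣ) : F) else 0 := by
      intro i
      split_ifs with hi
      · simp [E, not_lt.2 hi]
      · rfl
    simp only [h1, h2, P]
  have hn := hT n hkn le_rfl
  have hcard : #{y : Fin n → Fˣ | MonomialSystem b₁ b₂ a₁ a₂ E₁ E₂ p₁ p₂ fun j => (y j : F)} =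
      #{w : Fin (p₁ + p₂) → Fˣ |
        P w ∧ IndexCond (Fintype.card F - 1) U s d fun i => (ind (w i) : ℤ)} *
        ((Fintype.card F - 1) ^ (n - s) *
          ∏ j ∈ range s, (Fintype.card F - 1).gcd (d j)) := by
    convert card_monomial_preimage hα hind (Fintype.card_units F) E (hM ▸ h) P using 2
    · ext y
      simp only [mem_filter, mem_univ, true_and, hP]
    · congr!
  rw [card_headNonzero_eq_card_units, hcard, Nat.sub_self, pow_zero, mul_one,
    show n - s = (k - s) + (n - k) by omega, pow_add] at hn
  rw [hT l hkl hl, Nat.card_eq_fintype_card, Fintype.card_subtype]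
  congr 2
  refine Nat.eq_of_mul_eq_mul_right (pow_pos hm (n - k)) (hn.symm.trans ?_)
  simp only [P, and_assoc]
  ring

open scoped Classical in
/-- The number of vectors with nonzero first `l` coordinates. -/
theorem card_headNonzero {F : Type*} [Field F] [Fintype F] {n l : ℕ}
    (hl : l ≤ n) :
    #{x : Fin n → F | HeadNonzero l x} =
      (Fintype.card F - 1) ^ l * Fintype.card F ^ (n - l) := by
  obtain ⟨T, hT⟩ := exists_card_cylinder (F := F) (Nat.zero_le n) (fun _ => True)
    fun _ _ _ => Iff.rfl
  have h0 := hT 0 le_rfl (Nat.zero_le n)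
  have h1 : T = 1 := by
    have : 0 < Fintype.card F ^ n := pow_pos Fintype.card_pos n
    refine Nat.eq_of_mul_eq_mul_right this ?_
    simpa [HeadNonzero] using h0.symm
  have h2 := hT l (Nat.zero_le l) hl
  simp only [true_and, h1, one_mul, Nat.sub_zero] at h2
  exact h2

open scoped Classical in
theorem card_and_headNonzero {F : Type*} [Field F] [Fintype F] {n l : ℕ} (hl : l ≤ n) (p : Prop) :
    #{x : Fin n → F | p ∧ HeadNonzero l x} =
      if p then (Fintype.card F - 1) ^ l * Fintype.card F ^ (n - l) else 0 := by
  split_ifs with hp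
  · rw [← card_headNonzero hl]
    congr 1
    ext x
    simp [hp]
  · simp [hp]

open scoped Classical in
theorem card_filter_add_card_filter {β : Type*} [Fintype β] {S S' C D : β → Prop}
    (hDC : ∀ x, D x → C x) (hS : ∀ x, ¬ D x → (S x ↔ S' x)) :
    #{x | S x ∧ C x} + #{x | S' x ∧ D x} = #{x | S' x ∧ C x} + #{x | S x ∧ D x} := by
  have key : ∀ R : β → Prop, #{x | R x ∧ C x} = #{x | R x ∧ D x} + #{x | R x ∧ C x ∧ ¬ D x} := by
    intro R
    rw [← Finset.card_filter_add_card_filter_not (s := univ.filter fun x => R x ∧ C x) D,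
      Finset.filter_filter, Finset.filter_filter]
    congr 2 <;> ext x <;> simp only [mem_filter, mem_univ, true_and] <;>
      have := hDC x <;> tauto
  have h : univ.filter (fun x => S x ∧ C x ∧ ¬ D x) =
      univ.filter fun x => S' x ∧ C x ∧ ¬ D x := by
    ext x
    have := hS x
    simp only [mem_filter, mem_univ, true_and]
    tauto
  rw [key S, key S', h]
  ring

theorem rational_points_case_n1_eq_n3_n4_lt_n2
    (F : Type) [Field F] [Fintype F] [DecidableEq F]
    (q : ℕ) (hq : q = Fintype.card F)
    (hqpow : ∃ p k : ℕ, Nat.Prime p ∧ Odd p ∧ 0 < k ∧ q = p ^ k)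
    (α : Fˣ) (hα : ∀ β : Fˣ, β ∈ Subgroup.zpowers α)
    (ind : Fˣ → ℕ)
    (hind : ∀ β : Fˣ, 1 ≤ ind β ∧ ind β ≤ q - 1 ∧ α ^ ind β = β)
    (r₁ r₂ r₃ r₄ n₁ n₂ n₃ n₄ : ℕ)
    (hr₁ : 0 < r₁) (hr₁₂ : r₁ < r₂) (hr₃ : 0 < r₃) (hr₃₄ : r₃ < r₄)
    (hn₁ : 0 < n₁) (hn₁₂ : n₁ < n₂) (hn₃ : 0 < n₃) (hn₃₄ : n₃ < n₄)
    (hn₁₃ : n₁ ≤ n₃)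
    (b₁ b₂ : F) (a₁ a₂ : ℕ → Fˣ)
    (E₁ E₂ : ℕ → ℕ → ℕ)
    (hE₁p : ∀ i, i < r₁ → ∀ j, j < n₁ → 0 < E₁ i j)
    (hE₁z : ∀ i, i < r₁ → ∀ j, n₁ ≤ j → E₁ i j = 0)
    (hE₁p' : ∀ i, r₁ ≤ i → i < r₂ → ∀ j, j < n₂ → 0 < E₁ i j)
    (hE₁z' : ∀ i, r₁ ≤ i → i < r₂ → ∀ j, n₂ ≤ j → E₁ i j = 0)
    (hE₂p : ∀ i, i < r₃ → ∀ j, j < n₃ → 0 < E₂ i j)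
    (hE₂z : ∀ i, i < r₃ → ∀ j, n₃ ≤ j → E₂ i j = 0)
    (hE₂p' : ∀ i, r₃ ≤ i → i < r₄ → ∀ j, j < n₄ → 0 < E₂ i j)
    (hE₂z' : ∀ i, r₃ ≤ i → i < r₄ → ∀ j, n₄ ≤ j → E₂ i j = 0)
    (h₁₃ : n₁ = n₃) (h₄₂ : n₄ < n₂)
    (U₃ : Matrix (Fin (r₁ + r₃)) (Fin (r₁ + r₃)) ℤ) (V₃ : Matrix (Fin (n₂)) (Fin (n₂)) ℤ)
    (s₃ : ℕ) (d₃ : ℕ → ℕ)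
    (hSD₃ : IsSmithDatum (stackM E₁ E₂ r₁ r₃ n₂) U₃ V₃ s₃ d₃)
    (U₂ : Matrix (Fin (r₂ + r₄)) (Fin (r₂ + r₄)) ℤ) (V₂ : Matrix (Fin (n₂)) (Fin (n₂)) ℤ)
    (s₂ : ℕ) (d₂ : ℕ → ℕ)
    (hSD₂ : IsSmithDatum (stackM E₁ E₂ r₂ r₄ n₂) U₂ V₂ s₂ d₂)
    (U₄ : Matrix (Fin (r₁ + r₄)) (Fin (r₁ + r₄)) ℤ) (V₄ : Matrix (Fin (n₂)) (Fin (n₂)) ℤ)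
    (s₄ : ℕ) (d₄ : ℕ → ℕ)
    (hSD₄ : IsSmithDatum (stackM E₁ E₂ r₁ r₄ n₂) U₄ V₄ s₄ d₄)
    (H₃ : ℕ)
    (hH₃ : H₃ = Nat.card {w : Fin (r₁ + r₃) → Fˣ //
      (∑ i : Fin (r₁ + r₃), if (i : ℕ) < r₁ then (a₁ (i : ℕ) : F) * ((w i : F)) else 0) = b₁ ∧
      (∑ i : Fin (r₁ + r₃), if r₁ ≤ (i : ℕ) then (a₂ ((i : ℕ) - r₁) : F) * ((w i : F)) else 0) = b₂ ∧
      IndexCond (q - 1) U₃ s₃ d₃ fun i => (ind (w i) : ℤ)})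
    (H₂ : ℕ)
    (hH₂ : H₂ = Nat.card {w : Fin (r₂ + r₄) → Fˣ //
      (∑ i : Fin (r₂ + r₄), if (i : ℕ) < r₂ then (a₁ (i : ℕ) : F) * ((w i : F)) else 0) = b₁ ∧
      (∑ i : Fin (r₂ + r₄), if r₂ ≤ (i : ℕ) then (a₂ ((i : ℕ) - r₂) : F) * ((w i : F)) else 0) = b₂ ∧
      IndexCond (q - 1) U₂ s₂ d₂ fun i => (ind (w i) : ℤ)})
    (H₄ : ℕ)
    (hH₄ : H₄ = Nat.card {w : Fin (r₁ + r₄) → Fˣ //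
      (∑ i : Fin (r₁ + r₄), if (i : ℕ) < r₁ then (a₁ (i : ℕ) : F) * ((w i : F)) else 0) = b₁ ∧
      (∑ i : Fin (r₁ + r₄), if r₁ ≤ (i : ℕ) then (a₂ ((i : ℕ) - r₁) : F) * ((w i : F)) else 0) = b₂ ∧
      IndexCond (q - 1) U₄ s₄ d₄ fun i => (ind (w i) : ℤ)})
    (L₂ : ℕ)
    (hL₂ : L₂ = H₂ * (q - 1) ^ (n₂ - s₂) * ∏ j ∈ Finset.range s₂, Nat.gcd (q - 1) (d₂ j))
    (L₃ : ℕ)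
    (hL₃ : L₃ = H₃ * (q - 1) ^ (n₃ - s₃) * ∏ j ∈ Finset.range s₃, Nat.gcd (q - 1) (d₃ j))
    (L₄ : ℕ)
    (hL₄ : L₄ = H₄ * (q - 1) ^ (n₄ - s₄) * ∏ j ∈ Finset.range s₄, Nat.gcd (q - 1) (d₄ j))
    :
    Nat.card {x : Fin (n₂) → F //
      (∑ i ∈ Finset.range r₂, (a₁ i : F) * ∏ j : Fin (n₂), x j ^ E₁ i (j : ℕ)) = b₁ ∧
      (∑ i ∈ Finset.range r₄, (a₂ i : F) * ∏ j : Fin (n₂), x j ^ E₂ i (j : ℕ)) = b₂} =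
      (if b₁ = 0 ∧ b₂ = 0 then q ^ (n₂ - n₁) * (q ^ n₁ - (q - 1) ^ n₁) else 0) +
      q ^ (n₂ - n₄) * (q ^ (n₄ - n₃) - (q - 1) ^ (n₄ - n₃)) * L₃ +
      L₂ +
      (q ^ (n₂ - n₄) - (q - 1) ^ (n₂ - n₄)) * L₄ := by
  classical
  subst hq
  have hα' := fun β => (hind β).2.2
  have hq1 : Fintype.card F - 1 ≤ Fintype.card F := Nat.sub_le _ _
  have hC : ∀ {k l : ℕ}, k ≤ l → ∀ x : Fin n₂ → F, HeadNonzero l x → HeadNonzero k x :=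
    fun hkl x hx j hj => hx j (hj.trans_le hkl)
  have hE₁n : ∀ i, i < r₂ → ∀ j, n₂ ≤ j → E₁ i j = 0 := fun i hi j hj => by
    rcases lt_or_ge i r₁ with h | h
    · exact hE₁z i h j (by omega)
    · exact hE₁z' i h hi j hj
  have hE₂n : ∀ i, i < r₄ → ∀ j, n₄ ≤ j → E₂ i j = 0 := fun i hi j hj => by
    rcases lt_or_ge i r₃ with h | h
    · exact hE₂z i h j (by omega)
    · exact hE₂z' i h hi j hj
  have hE₁pos : ∀ i, i < r₂ → ∀ j, j < n₁ → 0 < E₁ i j := fun i hi j hj => by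
    rcases lt_or_ge i r₁ with h | h
    · exact hE₁p i h j hj
    · exact hE₁p' i h hi j (by omega)
  have hE₂pos : ∀ i, i < r₄ → ∀ j, j < n₁ → 0 < E₂ i j := fun i hi j hj => by
    rcases lt_or_ge i r₃ with h | h
    · exact hE₂p i h j (by omega)
    · exact hE₂p' i h hi j (by omega)
  have t₁ : ∀ x : Fin n₂ → F, ¬ HeadNonzero n₁ x →
      (MonomialSystem b₁ b₂ a₁ a₂ E₁ E₂ r₂ r₄ x ↔ (b₁ = 0 ∧ b₂ = 0)) := fun x hx => by
    simp only [MonomialSystem]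
    rw [sum_range_truncate (Nat.zero_le r₂) a₁ E₁ (fun i _ hi j hj => hE₁pos i hi j hj) hx,
      sum_range_truncate (Nat.zero_le r₄) a₂ E₂ (fun i _ hi j hj => hE₂pos i hi j hj) hx,
      sum_range_zero, sum_range_zero, eq_comm, eq_comm (a := (0 : F)) (b := b₂)]
  have t₂ : ∀ x : Fin n₂ → F, ¬ HeadNonzero n₄ x →
      (MonomialSystem b₁ b₂ a₁ a₂ E₁ E₂ r₂ r₄ x ↔
        MonomialSystem b₁ b₂ a₁ a₂ E₁ E₂ r₁ r₃ x) := fun x hx => by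
    simp only [MonomialSystem]
    rw [sum_range_truncate hr₁₂.le a₁ E₁ (fun i h hi j hj => hE₁p' i h hi j (by omega)) hx,
      sum_range_truncate hr₃₄.le a₂ E₂ (fun i h hi j hj => hE₂p' i h hi j hj) hx]
  have t₃ : ∀ x : Fin n₂ → F, ¬ HeadNonzero n₂ x →
      (MonomialSystem b₁ b₂ a₁ a₂ E₁ E₂ r₂ r₄ x ↔
        MonomialSystem b₁ b₂ a₁ a₂ E₁ E₂ r₁ r₄ x) := fun x hx => by
    simp only [MonomialSystem]
    rw [sum_range_truncate hr₁₂.le a₁ E₁ (fun i h hi j hj => hE₁p' i h hi j hj) hx]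
  have c₃ := card_monomialSystem hα hα' b₁ b₂ a₁ a₂ E₁ E₂ r₁ r₃ (show n₃ ≤ n₂ by omega)
    (fun i hi j hj => hE₁z i hi j (by omega)) hE₂z hSD₃
  have c₂ := card_monomialSystem hα hα' b₁ b₂ a₁ a₂ E₁ E₂ r₂ r₄ le_rfl hE₁n
    (fun i hi j hj => hE₂n i hi j (by omega)) hSD₂
  have c₄ := card_monomialSystem hα hα' b₁ b₂ a₁ a₂ E₁ E₂ r₁ r₄ h₄₂.le
    (fun i hi j hj => hE₁z i hi j (by omega)) hE₂n hSD₄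
  rw [← hH₃, ← hL₃] at c₃
  rw [← hH₂, ← hL₂] at c₂
  rw [← hH₄, ← hL₄] at c₄
  have e₁ := card_filter_add_card_filter (S := MonomialSystem b₁ b₂ a₁ a₂ E₁ E₂ r₂ r₄)
    (C := HeadNonzero 0)
    (fun x hx => hC (Nat.zero_le n₁) x hx) t₁
  have e₂ := card_filter_add_card_filter (S := MonomialSystem b₁ b₂ a₁ a₂ E₁ E₂ r₂ r₄)
    (C := HeadNonzero n₃)
    (fun x hx => hC hn₃₄.le x hx) t₂
  have e₃ := card_filter_add_card_filter (S := MonomialSystem b₁ b₂ a₁ a₂ E₁ E₂ r₂ r₄)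
    (C := HeadNonzero n₄)
    (fun x hx => hC h₄₂.le x hx) t₃
  rw [c₃ n₃ le_rfl (by omega), c₃ n₄ hn₃₄.le h₄₂.le] at e₂
  rw [c₄ n₄ le_rfl h₄₂.le, c₄ n₂ h₄₂.le le_rfl, c₂ n₂ le_rfl le_rfl] at e₃
  have e₀ : Nat.card {x : Fin n₂ → F //
      (∑ i ∈ Finset.range r₂, (a₁ i : F) * ∏ j : Fin n₂, x j ^ E₁ i (j : ℕ)) = b₁ ∧
      (∑ i ∈ Finset.range r₄, (a₂ i : F) * ∏ j : Fin n₂, x j ^ E₂ i (j : ℕ)) = b₂} =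
      #{x : Fin n₂ → F | MonomialSystem b₁ b₂ a₁ a₂ E₁ E₂ r₂ r₄ x ∧ HeadNonzero 0 x} := by
    rw [Nat.card_eq_fintype_card, Fintype.card_subtype]
    simp [HeadNonzero, MonomialSystem]
  rw [card_and_headNonzero (Nat.zero_le _), card_and_headNonzero hn₁₂.le] at e₁
  rw [e₀]
  subst h₁₃
  generalize Fintype.card F - 1 = m at *
  generalize Fintype.card F = q at *
  obtain ⟨δ₁, h₁⟩ := Nat.exists_eq_add_of_le (Nat.pow_le_pow_left hq1 n₁)
  obtain ⟨δ₂, h₂⟩ := Nat.exists_eq_add_of_le (Nat.pow_le_pow_left hq1 (n₄ - n₁))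
  obtain ⟨δ₃, h₃⟩ := Nat.exists_eq_add_of_le (Nat.pow_le_pow_left hq1 (n₂ - n₄))
  have s₁ : q ^ n₂ = q ^ (n₂ - n₁) * (m ^ n₁ + δ₁) := by
    rw [← h₁, ← pow_add, Nat.sub_add_cancel hn₁₂.le]
  have s₂ : q ^ (n₂ - n₁) = q ^ (n₂ - n₄) * (m ^ (n₄ - n₁) + δ₂) := by
    rw [← h₂, ← pow_add]
    congr 1
    omega
  rw [h₁, h₂, h₃, Nat.add_sub_cancel_left, Nat.add_sub_cancel_left, Nat.add_sub_cancel_left]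
  simp only [Nat.sub_self, Nat.sub_zero, pow_zero, mul_one, one_mul] at e₁ e₂ e₃
  rw [s₂] at e₂
  rw [h₃] at e₃ e₂
  split_ifs at e₁ ⊢ with hb
  · rw [s₁] at e₁
    linarith
  · linarith
end
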